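/- There exist absolute constants C > 0 and p > 0 such that the following holds. For every d ≥ 1 and every connected d-regular locally arc-transitive simple graph G on N ≥ 3 vertices with a unique marked vertex m, taking self-loop weight ℓ = d/N, there exists an integer t with 0 ≤ t ≤ C·√(HT(P,{m})) such that the probability that measuring the vertex register of U_lazy^t |init_lazy⟩ yields the marked vertex, namely Σ_{a ∈ {e_1,…,e_d,↻}} |⟨m, a| U_lazy^t |init_lazy⟩|², is at least p. -/

import Mathlib

open scoped BigOperators ComplexConjugate
open Complex

set_option linter.unusedSectionVars false

noncomputable section

namespace LQWPaper

variable {V : Type*} [Fintype V] [DecidableEq V]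

/-- The inner product `⟨v,w⟩ = Σᵢ conj (v i) * w i` on `ι → ℂ`. -/
def cip {ι : Type*} [Fintype ι] (v w : ι → ℂ) : ℂ :=
  ∑ i, (starRingEnd ℂ) (v i) * w i

/-- The `ℓ₂`-norm on `ι → ℂ`. -/
def l2norm {ι : Type*} [Fintype ι] (v : ι → ℂ) : ℝ :=
  Real.sqrt (∑ i, Complex.normSq (v i))

/-- The operator norm (with respect to the `ℓ₂`-norm) of a square matrix. -/
def opNorm {ι : Type*} [Fintype ι] (M : Matrix ι ι ℂ) : ℝ :=
  sSup {r : ℝ | ∃ v : ι → ℂ, l2norm v = 1 ∧ r = l2norm (M.mulVec v)}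

/-- A fixed labeling `y_1(x), …, y_d(x)` of the `d` neighbors of each vertex of a
`d`-regular graph: a bijection from `Fin d` to the neighbor set of each vertex. -/
structure Labeling (G : SimpleGraph V) (d : ℕ) where
  nbr : (x : V) → Fin d ≃ (G.neighborSet x)

lemma Labeling.adj {G : SimpleGraph V} {d : ℕ} (L : Labeling G d) (x : V) (i : Fin d) :
    G.Adj x (L.nbr x i) := (L.nbr x i).prop

/-- The (unique) index of `x` among the neighbors of `y`. -/
def Labeling.idx {G : SimpleGraph V} {d : ℕ} (L : Labeling G d) (y x : V)
    (h : G.Adj y x) : Fin d := (L.nbr y).symm ⟨x, h⟩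

/-- The flip-flop shift on basis states: `|x, e_i⟩ ↦ |y, e_j⟩` where `y = y_i(x)` and
`x = y_j(y)`, and `|x, ↻⟩ ↦ |x, ↻⟩`.  The self-loop is the coin index `Fin.last d`. -/
def shiftFun {G : SimpleGraph V} {d : ℕ} (L : Labeling G d)
    (p : V × Fin (d + 1)) : V × Fin (d + 1) :=
  if h : p.2 = Fin.last d then p
  else
    let i : Fin d := p.2.castPred h
    ⟨L.nbr p.1 i, Fin.castSucc (L.idx (L.nbr p.1 i) p.1 ((L.adj p.1 i).symm))⟩

/-- The flip-flop shift operator `S` as a matrix. -/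
def shiftMat {G : SimpleGraph V} {d : ℕ} (L : Labeling G d) :
    Matrix (V × Fin (d + 1)) (V × Fin (d + 1)) ℂ :=
  Matrix.of fun p q => if p = shiftFun L q then 1 else 0

/-- The coin state `|c⟩ = (1/√(d+ℓ)) (|e_1⟩ + ⋯ + |e_d⟩ + √ℓ |↻⟩)`. -/
def coinVec (d : ℕ) (ℓ : ℝ) : Fin (d + 1) → ℂ :=
  fun a => if a = Fin.last d then ((Real.sqrt ℓ / Real.sqrt (d + ℓ) : ℝ) : ℂ)
           else ((1 / Real.sqrt (d + ℓ) : ℝ) : ℂ)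

/-- The coin operator `C = 2|c⟩⟨c| − I`. -/
def coinMat (d : ℕ) (ℓ : ℝ) : Matrix (Fin (d + 1)) (Fin (d + 1)) ℂ :=
  (2 : ℂ) • Matrix.of (fun a b => coinVec d ℓ a * (starRingEnd ℂ) (coinVec d ℓ b)) - 1

/-- The global coin operator `I_N ⊗ C`. -/
def coinLift (d : ℕ) (ℓ : ℝ) :
    Matrix (V × Fin (d + 1)) (V × Fin (d + 1)) ℂ :=
  Matrix.of fun p q => if p.1 = q.1 then coinMat d ℓ p.2 q.2 else 0

/-- The oracle `G_or = (I_N − 2|m⟩⟨m|) ⊗ I_{d+1}`. -/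
def oracleMat (d : ℕ) (m : V) : Matrix (V × Fin (d + 1)) (V × Fin (d + 1)) ℂ :=
  Matrix.of fun p q => if p = q then (if p.1 = m then -1 else 1) else 0

/-- The lackadaisical quantum walk `U_lazy = S · (I_N ⊗ C) · G_or`. -/
def Ulazy {G : SimpleGraph V} {d : ℕ} (L : Labeling G d) (m : V) (ℓ : ℝ) :
    Matrix (V × Fin (d + 1)) (V × Fin (d + 1)) ℂ :=
  shiftMat L * coinLift d ℓ * oracleMat d m

/-- The initial state `|init_lazy⟩ = (1/√(N−1)) Σ_{x ≠ m} |x⟩ ⊗ |c⟩`. -/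
def initLazy (m : V) (d : ℕ) (ℓ : ℝ) : V × Fin (d + 1) → ℂ :=
  fun p => if p.1 = m then 0
    else ((1 / Real.sqrt ((Fintype.card V : ℝ) - 1) : ℝ) : ℂ) * coinVec d ℓ p.2

/-- The state `|⇒⟩ = (1/√d)(|e_1⟩ + ⋯ + |e_d⟩)`. -/
def plusVec (d : ℕ) : Fin (d + 1) → ℂ :=
  fun a => if a = Fin.last d then 0 else ((1 / Real.sqrt d : ℝ) : ℂ)

/-- The modified oracle `Ĝ_or = I − 2(|m,↻⟩⟨m,↻| + |m,⇒⟩⟨m,⇒|)`. -/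
def oracleHat (d : ℕ) (m : V) : Matrix (V × Fin (d + 1)) (V × Fin (d + 1)) ℂ :=
  1 - (2 : ℂ) • Matrix.of (fun p q =>
    (if p = (m, Fin.last d) ∧ q = (m, Fin.last d) then 1 else 0)
    + (if p.1 = m ∧ q.1 = m then plusVec d p.2 * (starRingEnd ℂ) (plusVec d q.2) else 0))

/-- The modified lackadaisical quantum walk `Û_lazy = S · (I_N ⊗ C) · Ĝ_or`. -/
def UlazyHat {G : SimpleGraph V} {d : ℕ} (L : Labeling G d) (m : V) (ℓ : ℝ) :
    Matrix (V × Fin (d + 1)) (V × Fin (d + 1)) ℂ :=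
  shiftMat L * coinLift d ℓ * oracleHat d m

/-- The action of an automorphism `σ` of `G` on arcs and self-loops:
`P_σ |x, e_i⟩ = |σ x, e_j⟩` with `y_j(σ x) = σ (y_i x)`, and `P_σ |x, ↻⟩ = |σ x, ↻⟩`. -/
def permFun {G : SimpleGraph V} {d : ℕ} (L : Labeling G d) (σ : G ≃g G)
    (p : V × Fin (d + 1)) : V × Fin (d + 1) :=
  if h : p.2 = Fin.last d then (σ p.1, p.2)
  else
    let i : Fin d := p.2.castPred h
    ⟨σ p.1, Fin.castSucc (L.idx (σ p.1) (σ (L.nbr p.1 i)) (σ.map_adj_iff.mpr (L.adj p.1 i)))⟩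

/-- The unitary `P_σ` induced by an automorphism `σ` of `G`, as a matrix. -/
def permMat {G : SimpleGraph V} {d : ℕ} (L : Labeling G d) (σ : G ≃g G) :
    Matrix (V × Fin (d + 1)) (V × Fin (d + 1)) ℂ :=
  Matrix.of fun p q => if p = permFun L σ q then 1 else 0

/-- `G` is locally arc-transitive if for any vertex `u` with neighbors `v₁, v₂` there is an
automorphism of `G` fixing `u` and mapping `v₁` to `v₂`. -/
def LocallyArcTransitive (G : SimpleGraph V) : Prop :=
  ∀ u v₁ v₂ : V, G.Adj u v₁ → G.Adj u v₂ → ∃ σ : G ≃g G, σ u = u ∧ σ v₁ = v₂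

/-- The transition matrix `P` of the simple random walk on a `d`-regular graph. -/
def Pmat (G : SimpleGraph V) [DecidableRel G.Adj] (d : ℕ) : Matrix V V ℝ :=
  Matrix.of fun x y => if G.Adj x y then (1 : ℝ) / d else 0

/-- The absorbing walk: row `m` is replaced by the unit vector at `m`. -/
def absorb (M : Matrix V V ℝ) (m : V) : Matrix V V ℝ :=
  Matrix.of fun x y => if x = m then (if y = m then 1 else 0) else M x y

/-- The interpolated walk `M(s) = (1−s) M + s M'`. -/
def interp (M : Matrix V V ℝ) (m : V) (s : ℝ) : Matrix V V ℝ :=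
  (1 - s) • M + s • absorb M m

/-- The lazy random walk `P̂ = (d/(d+ℓ)) P + (ℓ/(d+ℓ)) I`. -/
def lazyP (G : SimpleGraph V) [DecidableRel G.Adj] (d : ℕ) (ℓ : ℝ) : Matrix V V ℝ :=
  ((d : ℝ) / (d + ℓ)) • Pmat G d + (ℓ / (d + ℓ)) • (1 : Matrix V V ℝ)

/-- The submatrix `Q` of `P` obtained by deleting the row and column of `m`. -/
def Qsub (P : Matrix V V ℝ) (m : V) :
    Matrix {x : V // x ≠ m} {x : V // x ≠ m} ℝ :=
  Matrix.of fun x y => P x.1 y.1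

/-- The hitting time `HT(P, {m}) = Σ_{t≥0} (1/N) Σ_{x≠m, y≠m} (Q^t)_{xy}`. -/
def hittingTime (P : Matrix V V ℝ) (m : V) : ℝ :=
  ∑' t : ℕ, (1 / (Fintype.card V : ℝ)) *
    ∑ x : {x : V // x ≠ m}, ∑ y : {x : V // x ≠ m}, (Qsub P m ^ t) x y

/-- The state `|x⟩ ⊗ |P(s)_x⟩ = Σ_y √(P(s)_{xy}) |x,y⟩`. -/
def psVec (Ps : Matrix V V ℝ) (x : V) : V × V → ℂ :=
  fun p => if p.1 = x then ((Real.sqrt (Ps x p.2) : ℝ) : ℂ) else 0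

/-- The projection `Π_A = Σ_x |x, P(s)_x⟩⟨x, P(s)_x|` onto `span{|x⟩ ⊗ |P(s)_x⟩}`. -/
def projA (Ps : Matrix V V ℝ) : Matrix (V × V) (V × V) ℂ :=
  Matrix.of fun p q => ∑ x, psVec Ps x p * (starRingEnd ℂ) (psVec Ps x q)

/-- The swap of the two tensor factors of `ℂ^V ⊗ ℂ^V`, as a matrix. -/
def swapMat (V : Type*) [Fintype V] [DecidableEq V] : Matrix (V × V) (V × V) ℂ :=
  Matrix.of fun p q => if p.1 = q.2 ∧ p.2 = q.1 then 1 else 0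

/-- Szegedy's quantum walk `W = SWAP · (2Π_A − I)` of a walk with matrix `Ps`. -/
def Wmat (Ps : Matrix V V ℝ) : Matrix (V × V) (V × V) ℂ :=
  swapMat V * ((2 : ℂ) • projA Ps - 1)

/-- The initial state `|init_ip⟩ = (1/√(N−1)) Σ_{x ≠ m} |x⟩ ⊗ |P(s)_x⟩`. -/
def initIp (Ps : Matrix V V ℝ) (m : V) : V × V → ℂ :=
  fun p => if p.1 = m then 0
    else ((1 / Real.sqrt ((Fintype.card V : ℝ) - 1) : ℝ) : ℂ) * ((Real.sqrt (Ps p.1 p.2) : ℝ) : ℂ)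

/-- The discriminant matrix, `D_{xy} = √(M_{xy} M_{yx})`. -/
def discr (M : Matrix V V ℝ) : Matrix V V ℝ :=
  Matrix.of fun x y => Real.sqrt (M x y * M y x)

/-- The unit vector `√π̄ = (1/√(N−1)) Σ_{x ≠ m} |x⟩`. -/
def sqrtPiBar (m : V) : V → ℝ :=
  fun x => if x = m then 0 else 1 / Real.sqrt ((Fintype.card V : ℝ) - 1)

/-- `(θ, φ)` is an orthonormal eigenbasis of the (unitary) matrix `M`, with
eigenvalues `e^{iθ_k}` and eigenvectors `φ_k`. -/
def IsONEigenbasis {ι : Type*} [Fintype ι] [DecidableEq ι] (M : Matrix ι ι ℂ)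
    (θ : ι → ℝ) (φ : ι → (ι → ℂ)) : Prop :=
  (∀ k l, cip (φ k) (φ l) = if k = l then 1 else 0) ∧
  (∀ k, M.mulVec (φ k) = Complex.exp ((θ k : ℂ) * Complex.I) • φ k)

/-- The squared cotangent quantum hitting time
`QHT(U, w)² = Σ_{e^{iθ_k} ≠ 1} |⟨φ_k|w⟩|² cot²(θ_k/2)` computed in the
orthonormal eigenbasis `(θ, φ)`. -/
def QHTsq {ι : Type*} [Fintype ι] (θ : ι → ℝ) (φ : ι → (ι → ℂ)) (w : ι → ℂ) : ℝ :=
  ∑ k, if Complex.exp ((θ k : ℂ) * Complex.I) = 1 then 0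
       else Complex.normSq (cip (φ k) w) * (Real.cos (θ k / 2) / Real.sin (θ k / 2)) ^ 2

/-- `(lam, v)` is a real orthonormal eigenbasis of the symmetric matrix `M`. -/
def IsRealONEigenbasis (M : Matrix V V ℝ) (lam : V → ℝ) (v : V → (V → ℝ)) : Prop :=
  (∀ k l, (∑ x, v k x * v l x) = if k = l then 1 else 0) ∧
  (∀ k, M.mulVec (v k) = lam k • v k)

/-- The interpolated hitting time `HT⁺ = Σ_{λ_k ≠ 1} |⟨λ_k|√π̄⟩|² / (1 − λ_k)`,
computed in the orthonormal eigenbasis `(lam, v)` of the discriminant. -/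
def HTplus (lam : V → ℝ) (v : V → (V → ℝ)) (m : V) : ℝ :=
  ∑ k, if lam k = 1 then 0 else (∑ x, v k x * sqrtPiBar m x) ^ 2 / (1 - lam k)

/-- The map `E : ℂ^V ⊗ ℂ^V → ℂ^V ⊗ ℂ^{d+1}` with `E|x, y_i(x)⟩ = |x, e_i⟩`,
`E|x,x⟩ = |x,↻⟩` for `x ≠ m`, `E|m,m⟩ = −|m,↻⟩`, and `E|x,y⟩ = 0` otherwise. -/
def Emat {G : SimpleGraph V} [DecidableRel G.Adj] {d : ℕ}
    (L : Labeling G d) (m : V) : Matrix (V × Fin (d + 1)) (V × V) ℂ :=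
  Matrix.of fun p q =>
    if h : G.Adj q.1 q.2 then
      (if p = (q.1, Fin.castSucc (L.idx q.1 q.2 h)) then 1 else 0)
    else if q.2 = q.1 then
      (if p = (q.1, Fin.last d) then (if q.1 = m then -1 else 1) else 0)
    else 0

/-- `SWAP` applied to a vector of `ℂ^V ⊗ ℂ^V`. -/
def swapVecC (v : V × V → ℂ) : V × V → ℂ := fun p => v (p.2, p.1)

/-- The unit vector `|x, Ps_x^⊥⟩` orthogonal to `|x, Ps_x⟩` in
`span{|x, Ps_x⟩, SWAP |x, Ps_x⟩}` (Gram–Schmidt phase convention). -/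
def perpVec (Ps : Matrix V V ℝ) (x : V) : V × V → ℂ :=
  fun p =>
    (swapVecC (psVec Ps x) - cip (psVec Ps x) (swapVecC (psVec Ps x)) • psVec Ps x) p
      / ((l2norm (swapVecC (psVec Ps x) - cip (psVec Ps x) (swapVecC (psVec Ps x)) • psVec Ps x) : ℝ) : ℂ)

/-- The isometry `Σ_x (|x, Ps1_x⟩⟨x, Ps2_x| + |x, Ps1_x^⊥⟩⟨x, Ps2_x^⊥|)`;
`R₁ = Rmat P̂(s) P(s)` and `R₂ = Rmat P(s) P(s)`. -/
def Rmat (Ps1 Ps2 : Matrix V V ℝ) : Matrix (V × V) (V × V) ℂ :=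
  Matrix.of fun p q => ∑ x, (psVec Ps1 x p * (starRingEnd ℂ) (psVec Ps2 x q)
    + perpVec Ps1 x p * (starRingEnd ℂ) (perpVec Ps2 x q))

end LQWPaper

namespace LQWPaper

section Walk

variable {V : Type*} [Fintype V] [DecidableEq V] {G : SimpleGraph V} {d : ℕ}

lemma shiftFun_last (L : Labeling G d) (x : V) :
    shiftFun L (x, Fin.last d) = (x, Fin.last d) := by
  simp [shiftFun]

lemma shiftFun_castSucc (L : Labeling G d) (x : V) (i : Fin d) :
    shiftFun L (x, i.castSucc) =
      ((L.nbr x i : V), (L.idx (L.nbr x i) x (L.adj x i).symm).castSucc) := by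
  simp [shiftFun, (Fin.castSucc_lt_last i).ne]

lemma Labeling.nbr_idx (L : Labeling G d) (y x : V) (h : G.Adj y x) :
    (L.nbr y (L.idx y x h) : V) = x := by
  simp [Labeling.idx]

lemma Labeling.idx_nbr (L : Labeling G d) (x z : V) (i : Fin d) (h : G.Adj x z)
    (hz : z = L.nbr x i) : L.idx x z h = i := by
  subst hz
  exact (L.nbr x).symm_apply_apply i

lemma shiftFun_involutive (L : Labeling G d) : Function.Involutive (shiftFun L) := by
  rintro ⟨x, a⟩
  induction a using Fin.lastCases with
  | last => simp [shiftFun_last]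
  | cast i =>
    rw [shiftFun_castSucc, shiftFun_castSucc]
    have e : (L.nbr (L.nbr x i) (L.idx (L.nbr x i) x (L.adj x i).symm) : V) = x :=
      L.nbr_idx _ _ _
    refine Prod.ext e ?_
    simp only
    congr 1
    have gen : ∀ (w : V) (hw : w = x) (h : G.Adj w (L.nbr x i)), L.idx w (L.nbr x i) h = i := by
      rintro w rfl h
      exact L.idx_nbr _ _ _ h rfl
    exact gen _ e _

/-- The coin state scaled by `√(d + ℓ)`. -/
def coinWeight (d : ℕ) (ℓ : ℝ) (a : Fin (d + 1)) : ℝ :=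
  if a = Fin.last d then Real.sqrt ℓ else 1

@[simp] lemma coinWeight_last (ℓ : ℝ) : coinWeight d ℓ (Fin.last d) = Real.sqrt ℓ := by
  simp [coinWeight]

@[simp] lemma coinWeight_castSucc (ℓ : ℝ) (i : Fin d) : coinWeight d ℓ i.castSucc = 1 := by
  simp [coinWeight, (Fin.castSucc_lt_last i).ne]

lemma coinVec_eq (ℓ : ℝ) (a : Fin (d + 1)) :
    coinVec d ℓ a = ((coinWeight d ℓ a / Real.sqrt (d + ℓ) : ℝ) : ℂ) := by
  unfold coinVec coinWeight
  split_ifs <;> rfl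

lemma sum_coinWeight_sq {ℓ : ℝ} (hℓ : 0 ≤ ℓ) : ∑ a, coinWeight d ℓ a ^ 2 = d + ℓ := by
  simp [Fin.sum_univ_castSucc, Real.sq_sqrt hℓ]

/-- The operator `(I ⊗ C) · G_or` on real vectors. -/
def coinStep (m : V) (ℓ : ℝ) :
    (V × Fin (d + 1) → ℝ) →ₗ[ℝ] (V × Fin (d + 1) → ℝ) where
  toFun v p := (if p.1 = m then -1 else 1) *
    (2 / (d + ℓ) * coinWeight d ℓ p.2 * ∑ b, coinWeight d ℓ b * v (p.1, b) - v p)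
  map_add' v w := by
    ext p
    simp only [Pi.add_apply, mul_add, Finset.sum_add_distrib]
    ring
  map_smul' c v := by
    ext p
    simp only [Pi.smul_apply, smul_eq_mul, RingHom.id_apply, mul_left_comm _ c,
      ← Finset.mul_sum]
    ring

/-- The lackadaisical quantum walk on real vectors. -/
def walkStep (L : Labeling G d) (m : V) (ℓ : ℝ) :
    Module.End ℝ (V × Fin (d + 1) → ℝ) :=
  LinearMap.funLeft ℝ ℝ (shiftFun L) ∘ₗ coinStep m ℓ

lemma walkStep_apply (L : Labeling G d) (m : V) (ℓ : ℝ) (v : V × Fin (d + 1) → ℝ)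
    (p : V × Fin (d + 1)) : walkStep L m ℓ v p = coinStep m ℓ v (shiftFun L p) := rfl

lemma sum_coinStep_sq (m : V) {ℓ : ℝ} (hℓ : 0 ≤ ℓ) (hd : 1 ≤ d) (v : V × Fin (d + 1) → ℝ) :
    ∑ p, coinStep m ℓ v p ^ 2 = ∑ p, v p ^ 2 := by
  have hpos : (0 : ℝ) < d + ℓ := by
    have : (1 : ℝ) ≤ d := by exact_mod_cast hd
    linarith
  simp only [Fintype.sum_prod_type]
  refine Finset.sum_congr rfl fun x _ => ?_
  set A := ∑ b, coinWeight d ℓ b * v (x, b) with hA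
  have expand : ∀ a : Fin (d + 1), coinStep m ℓ v (x, a) ^ 2 =
      (2 / (d + ℓ) * A) ^ 2 * coinWeight d ℓ a ^ 2
        - 2 * (2 / (d + ℓ) * A) * (coinWeight d ℓ a * v (x, a)) + v (x, a) ^ 2 := by
    intro a
    simp only [coinStep, LinearMap.coe_mk, AddHom.coe_mk]
    rw [← hA]
    split_ifs <;> ring
  simp only [expand, Finset.sum_add_distrib, Finset.sum_sub_distrib, ← Finset.mul_sum,
    sum_coinWeight_sq hℓ, ← hA]
  field_simp
  ring

lemma sum_walkStep_sq (L : Labeling G d) (m : V) {ℓ : ℝ} (hℓ : 0 ≤ ℓ) (hd : 1 ≤ d)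
    (v : V × Fin (d + 1) → ℝ) : ∑ p, walkStep L m ℓ v p ^ 2 = ∑ p, v p ^ 2 := by
  rw [← sum_coinStep_sq m hℓ hd v]
  exact Equiv.sum_comp (shiftFun_involutive L).toPerm (fun p => coinStep m ℓ v p ^ 2)

lemma sum_walkStep_pow_sq (L : Labeling G d) (m : V) {ℓ : ℝ} (hℓ : 0 ≤ ℓ) (hd : 1 ≤ d)
    (v : V × Fin (d + 1) → ℝ) (t : ℕ) :
    ∑ p, (walkStep L m ℓ ^ t) v p ^ 2 = ∑ p, v p ^ 2 := by
  induction t with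
  | zero => simp
  | succ t ih => rw [pow_succ', Module.End.mul_apply, sum_walkStep_sq L m hℓ hd, ih]

lemma Ulazy_mulVec_ofReal (L : Labeling G d) (m : V) {ℓ : ℝ} (hℓ : 0 ≤ ℓ)
    (v : V × Fin (d + 1) → ℝ) :
    (Ulazy L m ℓ).mulVec (fun p => (v p : ℂ)) = fun p => (walkStep L m ℓ v p : ℂ) := by
  have hor : (oracleMat d m).mulVec (fun p => (v p : ℂ)) =
      fun p => (((if p.1 = m then -1 else 1) * v p : ℝ) : ℂ) := by
    ext p
    simp only [oracleMat, Matrix.mulVec, dotProduct, Matrix.of_apply, ite_mul, zero_mul,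
      Finset.sum_ite_eq, Finset.mem_univ, if_true]
    split_ifs <;> simp
  have hsq : Real.sqrt (d + ℓ) * Real.sqrt (d + ℓ) = d + ℓ :=
    Real.mul_self_sqrt (by positivity)
  have hcoin : ∀ w : V × Fin (d + 1) → ℝ, (coinLift d ℓ).mulVec (fun p => (w p : ℂ)) =
      fun p => ((2 / (d + ℓ) * coinWeight d ℓ p.2 *
        ∑ b, coinWeight d ℓ b * w (p.1, b) - w p : ℝ) : ℂ) := by
    intro w
    ext ⟨x, a⟩
    simp only [coinLift, Matrix.mulVec, dotProduct, Matrix.of_apply, ite_mul, zero_mul,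
      Fintype.sum_prod_type]
    rw [Finset.sum_eq_single x (fun y _ hy => by simp [hy.symm]) (by simp)]
    simp only [if_true, coinMat, Matrix.sub_apply, Matrix.smul_apply, Matrix.of_apply,
      Matrix.one_apply, sub_mul, ite_mul, one_mul, zero_mul, Finset.sum_sub_distrib,
      Finset.sum_ite_eq, Finset.mem_univ, coinVec_eq, Complex.conj_ofReal, smul_eq_mul]
    push_cast
    rw [Finset.mul_sum]
    congr 1
    refine Finset.sum_congr rfl fun b _ => ?_
    rw [show ((d : ℂ) + (ℓ : ℂ)) =
        ((Real.sqrt (d + ℓ) : ℝ) : ℂ) * ((Real.sqrt (d + ℓ) : ℝ) : ℂ) by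
      rw [← Complex.ofReal_mul, hsq]; push_cast; rfl]
    simp only [div_eq_mul_inv, mul_inv]
    ring
  have hshift : ∀ w : V × Fin (d + 1) → ℂ, (shiftMat L).mulVec w = fun p => w (shiftFun L p) := by
    intro w
    ext p
    simp only [shiftMat, Matrix.mulVec, dotProduct, Matrix.of_apply, ite_mul, one_mul, zero_mul]
    rw [Finset.sum_eq_single (shiftFun L p)]
    · rw [if_pos (shiftFun_involutive L p).symm]
    · intro q _ hq
      rw [if_neg]
      rintro rfl
      exact hq (shiftFun_involutive L q).symm
    · simp
  rw [Ulazy, ← Matrix.mulVec_mulVec, ← Matrix.mulVec_mulVec, hor, hcoin, hshift]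
  ext p
  rw [walkStep_apply]
  simp only [coinStep, LinearMap.coe_mk, AddHom.coe_mk, Complex.ofReal_inj]
  split_ifs
  · simp only [neg_one_mul, mul_neg, Finset.sum_neg_distrib]
    ring
  · simp

lemma Ulazy_pow_mulVec_ofReal (L : Labeling G d) (m : V) {ℓ : ℝ} (hℓ : 0 ≤ ℓ)
    (v : V × Fin (d + 1) → ℝ) (t : ℕ) :
    (Ulazy L m ℓ ^ t).mulVec (fun p => (v p : ℂ)) =
      fun p => ((walkStep L m ℓ ^ t) v p : ℂ) := by
  induction t with
  | zero => simp
  | succ t ih =>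
    rw [pow_succ', ← Matrix.mulVec_mulVec, ih, Ulazy_mulVec_ofReal L m hℓ, pow_succ']
    rfl

end Walk

section Poisson

variable {V : Type*} [Fintype V] [DecidableEq V] {G : SimpleGraph V} {d : ℕ}

lemma Labeling.sum_nbr [DecidableRel G.Adj] (L : Labeling G d) (x : V) (F : V → ℝ) :
    ∑ i, F (L.nbr x i) = ∑ y, if G.Adj x y then F y else 0 := by
  rw [Equiv.sum_comp (L.nbr x) (fun y => F y), ← Finset.sum_filter]
  exact (Finset.sum_subtype _ (by simp) F).symm

lemma Labeling.sum_sum_nbr_comm (L : Labeling G d) (F : V → V → ℝ) :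
    ∑ x, ∑ i, F x (L.nbr x i) = ∑ x, ∑ i, F (L.nbr x i) x := by
  classical
  have h1 : ∀ x, ∑ i, F x (L.nbr x i) = ∑ y, if G.Adj x y then F x y else 0 :=
    fun x => L.sum_nbr x (F x)
  have h2 : ∀ x, ∑ i, F (L.nbr x i) x = ∑ y, if G.Adj x y then F y x else 0 :=
    fun x => L.sum_nbr x (fun y => F y x)
  simp only [h1, h2]
  rw [Finset.sum_comm]
  simp only [G.adj_comm]

lemma Labeling.sum_sub_sq (L : Labeling G d) (f : V → ℝ) :
    ∑ x, ∑ i, (f x - f (L.nbr x i)) ^ 2 =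
      2 * ∑ x, f x * ∑ i, (f x - f (L.nbr x i)) := by
  have hc := L.sum_sum_nbr_comm (fun x y => f y * (f y - f x))
  have : ∀ x (i : Fin d), (f x - f (L.nbr x i)) ^ 2 =
      f x * (f x - f (L.nbr x i)) + f (L.nbr x i) * (f (L.nbr x i) - f x) :=
    fun x i => by ring
  simp only [this, Finset.sum_add_distrib, hc, Finset.mul_sum]
  rw [← Finset.sum_add_distrib]
  refine Finset.sum_congr rfl fun x _ => ?_
  rw [← Finset.sum_add_distrib]
  exact Finset.sum_congr rfl fun i _ => by ring

lemma eq_zero_of_harmonic (hG : G.Connected) (L : Labeling G d) (m : V) (f : V → ℝ)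
    (hm : f m = 0) (hf : ∀ x, x ≠ m → ∑ i, (f x - f (L.nbr x i)) = 0) : f = 0 := by
  have h0 : ∑ x, ∑ i, (f x - f (L.nbr x i)) ^ 2 = 0 := by
    rw [L.sum_sub_sq, Finset.sum_eq_zero, mul_zero]
    intro x _
    by_cases hx : x = m
    · rw [hx, hm, zero_mul]
    · rw [hf x hx, mul_zero]
  have hadj : ∀ x y, G.Adj x y → f x = f y := by
    intro x y hxy
    rw [Finset.sum_eq_zero_iff_of_nonneg fun x _ => Finset.sum_nonneg fun i _ => sq_nonneg _] at h0
    have h1 := h0 x (Finset.mem_univ x)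
    rw [Finset.sum_eq_zero_iff_of_nonneg fun i _ => sq_nonneg _] at h1
    have h2 := h1 (L.idx x y hxy) (Finset.mem_univ _)
    rw [L.nbr_idx] at h2
    exact sub_eq_zero.mp (pow_eq_zero_iff two_ne_zero |>.mp h2)
  ext x
  obtain ⟨p⟩ := hG.preconnected x m
  rw [Pi.zero_apply, ← hm]
  clear hm hf
  induction p with
  | nil => rfl
  | cons h _ ih => exact (hadj _ _ h).trans ih

/-- `h` is the expected hitting time of `m`, as a function of the starting vertex. -/
structure IsHittingFun (L : Labeling G d) (m : V) (h : V → ℝ) : Prop where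
  marked : h m = 0
  poisson : ∀ x, x ≠ m → ∑ i, (h x - h (L.nbr x i)) = d

lemma exists_isHittingFun (hG : G.Connected) (L : Labeling G d) (m : V) :
    ∃ h, IsHittingFun L m h := by
  let A : (V → ℝ) →ₗ[ℝ] (V → ℝ) :=
    { toFun := fun f x => if x = m then f m else ∑ i, (f x - f (L.nbr x i))
      map_add' := fun f g => by
        ext x
        simp only [Pi.add_apply]
        split_ifs
        · rfl
        · rw [← Finset.sum_add_distrib]
          exact Finset.sum_congr rfl fun i _ => by ring
      map_smul' := fun c f => by
        ext x
        simp only [Pi.smul_apply, smul_eq_mul, RingHom.id_apply]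
        split_ifs
        · rfl
        · rw [Finset.mul_sum]
          exact Finset.sum_congr rfl fun i _ => by ring }
  have hinj : Function.Injective A := by
    rw [injective_iff_map_eq_zero]
    intro f hf
    have hf' : ∀ x, (if x = m then f m else ∑ i, (f x - f (L.nbr x i))) = 0 := congrFun hf
    refine eq_zero_of_harmonic hG L m f (by simpa using hf' m) fun x hx => ?_
    simpa [hx] using hf' x
  obtain ⟨h, hh⟩ := LinearMap.injective_iff_surjective.mp hinj
    (fun x => if x = m then 0 else (d : ℝ))
  have hh' : ∀ x, (if x = m then h m else ∑ i, (h x - h (L.nbr x i))) =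
    if x = m then 0 else (d : ℝ) := congrFun hh
  refine ⟨h, by simpa using hh' m, fun x hx => ?_⟩
  have := hh' x
  rwa [if_neg hx, if_neg hx] at this

variable {L : Labeling G d} {m : V} {h : V → ℝ}

lemma IsHittingFun.unique (hG : G.Connected) {h' : V → ℝ} (hh : IsHittingFun L m h)
    (hh' : IsHittingFun L m h') : h = h' := by
  rw [← sub_eq_zero]
  refine eq_zero_of_harmonic hG L m _ (by simp [hh.marked, hh'.marked]) fun x hx => ?_
  have h1 := hh.poisson x hx
  rw [← hh'.poisson x hx, ← sub_eq_zero, ← Finset.sum_sub_distrib] at h1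
  rw [← h1]
  exact Finset.sum_congr rfl fun i _ => by simp only [Pi.sub_apply]; ring

lemma IsHittingFun.nonneg (hd : 1 ≤ d) (hh : IsHittingFun L m h) (x : V) : 0 ≤ h x := by
  obtain ⟨z, -, hz⟩ := Finset.exists_min_image Finset.univ h ⟨m, Finset.mem_univ m⟩
  by_cases hzm : z = m
  · rw [← hh.marked, ← hzm]
    exact hz x (Finset.mem_univ x)
  · have h1 := hh.poisson z hzm
    have h2 : ∑ i, (h z - h (L.nbr z i)) ≤ 0 :=
      Finset.sum_nonpos fun i _ => sub_nonpos.mpr (hz _ (Finset.mem_univ _))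
    have : (1 : ℝ) ≤ d := by exact_mod_cast hd
    linarith

lemma IsHittingFun.comp_aut (hh : IsHittingFun L m h) (σ : G ≃g G) (hσ : σ m = m) :
    IsHittingFun L m (h ∘ σ) := by
  classical
  refine ⟨by simp [hσ, hh.marked], fun x hx => ?_⟩
  have hx' : σ x ≠ m := fun e => hx (σ.injective (e.trans hσ.symm))
  rw [← hh.poisson (σ x) hx']
  simp only [Function.comp]
  rw [L.sum_nbr x (fun y => h (σ x) - h (σ y)), L.sum_nbr (σ x) (fun y => h (σ x) - h y),
    ← Equiv.sum_comp σ.toEquiv (fun y => if G.Adj (σ x) y then h (σ x) - h y else 0)]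
  refine Finset.sum_congr rfl fun y _ => ?_
  change _ = if G.Adj (σ x) (σ y) then _ else _
  simp only [σ.map_adj_iff]
  rfl

lemma IsHittingFun.nbr_marked (hG : G.Connected) (hLAT : LocallyArcTransitive G) (hd : 1 ≤ d)
    (hh : IsHittingFun L m h) (i : Fin d) : h (L.nbr m i) = Fintype.card V - 1 := by
  have hconst : ∀ j, h (L.nbr m j) = h (L.nbr m i) := by
    intro j
    obtain ⟨σ, hσm, hσ⟩ := hLAT m _ _ (L.adj m i) (L.adj m j)
    rw [← hσ]
    exact congrFun ((hh.comp_aut σ hσm).unique hG hh) _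
  have h0 : ∑ x, ∑ i, (h x - h (L.nbr x i)) = 0 := by
    have := L.sum_sum_nbr_comm (fun x y => h y)
    simp only [Finset.sum_sub_distrib] at this ⊢
    linarith
  rw [← Finset.add_sum_erase _ _ (Finset.mem_univ m),
    Finset.sum_congr rfl fun x hx => hh.poisson x (Finset.ne_of_mem_erase hx)] at h0
  simp only [hh.marked, hconst, Finset.sum_const, Finset.card_erase_of_mem (Finset.mem_univ m),
    Finset.card_univ, Fintype.card_fin, nsmul_eq_mul] at h0
  rw [Nat.cast_sub (Fintype.card_pos_iff.mpr ⟨m⟩)] at h0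
  have hd' : (d : ℝ) ≠ 0 := by
    have : d ≠ 0 := by omega
    exact_mod_cast this
  apply mul_left_cancel₀ hd'
  push_cast at h0
  linarith

lemma IsHittingFun.sum_sub_sq (hh : IsHittingFun L m h) :
    ∑ x, ∑ i, (h x - h (L.nbr x i)) ^ 2 = 2 * d * ∑ x, h x := by
  rw [L.sum_sub_sq, mul_assoc, Finset.mul_sum (a := (d : ℝ))]
  congr 1
  refine Finset.sum_congr rfl fun x _ => ?_
  by_cases hx : x = m
  · rw [hx, hh.marked, zero_mul, mul_zero]
  · rw [hh.poisson x hx, mul_comm]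

lemma IsHittingFun.Qsub_mulVec [DecidableRel G.Adj] (hd : 1 ≤ d) (hh : IsHittingFun L m h) :
    (Qsub (Pmat G d) m).mulVec (fun x => h x) = fun x => h x.1 - 1 := by
  have hd' : (d : ℝ) ≠ 0 := by
    have : d ≠ 0 := by omega
    exact_mod_cast this
  ext ⟨x, hx⟩
  have h1 := hh.poisson x hx
  simp only [Finset.sum_sub_distrib, Finset.sum_const, Finset.card_univ, Fintype.card_fin,
    nsmul_eq_mul] at h1
  rw [L.sum_nbr x h] at h1
  simp only [Matrix.mulVec, dotProduct, Qsub, Pmat, Matrix.of_apply]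
  have h2 : ∑ y : {y : V // y ≠ m}, (if G.Adj x y then (1 : ℝ) / d else 0) * h y =
      ∑ y, (if G.Adj x y then (1 : ℝ) / d else 0) * h y := by
    rw [← Finset.sum_subtype (Finset.univ.erase m) (by simp)
      (fun y => (if G.Adj x y then (1 : ℝ) / d else 0) * h y),
      ← Finset.add_sum_erase _ _ (Finset.mem_univ m), hh.marked, mul_zero, zero_add]
  rw [h2]
  have h3 : ∑ y, (if G.Adj x y then (1 : ℝ) / d else 0) * h y =
      (1 / d) * ∑ y, if G.Adj x y then h y else 0 := by
    rw [Finset.mul_sum]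
    exact Finset.sum_congr rfl fun y _ => by split_ifs <;> simp
  rw [h3]
  field_simp
  linarith

lemma IsHittingFun.hittingTime_eq [DecidableRel G.Adj] (hd : 1 ≤ d) (hh : IsHittingFun L m h) :
    hittingTime (Pmat G d) m = (1 / (Fintype.card V : ℝ)) * ∑ x, h x := by
  set Q := Qsub (Pmat G d) m with hQ
  set w : {x : V // x ≠ m} → ℝ := fun x => h x with hw
  have hQw : Q.mulVec w = w - 1 := hh.Qsub_mulVec hd
  have hQpos : ∀ t x y, 0 ≤ (Q ^ t) x y := by
    intro t
    induction t with
    | zero =>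
      intro x y
      rw [pow_zero, Matrix.one_apply]
      split_ifs <;> norm_num
    | succ t ih =>
      intro x y
      rw [pow_succ, Matrix.mul_apply]
      refine Finset.sum_nonneg fun z _ => mul_nonneg (ih x z) ?_
      simp only [hQ, Qsub, Pmat, Matrix.of_apply]
      split_ifs <;> positivity
  have hsum : ∀ t, ∑ x, ∑ y, (Q ^ t) x y =
      ∑ x, (Q ^ t).mulVec w x - ∑ x, (Q ^ (t + 1)).mulVec w x := by
    intro t
    rw [pow_succ, ← Finset.sum_sub_distrib]
    refine Finset.sum_congr rfl fun x _ => ?_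
    rw [← Matrix.mulVec_mulVec, hQw, Matrix.mulVec_sub, Pi.sub_apply, sub_sub_cancel]
    simp [Matrix.mulVec, dotProduct]
  have hwpos : ∀ x, 0 ≤ w x := fun x => hh.nonneg hd x
  set a : ℕ → ℝ := fun t => ∑ x, (Q ^ t).mulVec w x with ha
  have hapos : ∀ t, 0 ≤ a t := fun t => Finset.sum_nonneg fun x _ =>
    Finset.sum_nonneg fun y _ => mul_nonneg (hQpos t x y) (hwpos y)
  have hle : ∀ t, a t ≤ (∑ y, w y) * ∑ x, ∑ y, (Q ^ t) x y := by
    intro t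
    rw [Finset.mul_sum]
    refine Finset.sum_le_sum fun x _ => ?_
    rw [Finset.mul_sum]
    refine Finset.sum_le_sum fun y _ => ?_
    rw [mul_comm]
    exact mul_le_mul_of_nonneg_right
      (Finset.single_le_sum (fun z _ => hwpos z) (Finset.mem_univ y)) (hQpos t x y)
  have hpart : ∀ n, ∑ t ∈ Finset.range n, ∑ x, ∑ y, (Q ^ t) x y = a 0 - a n := by
    intro n
    simp only [hsum]
    exact Finset.sum_range_sub' a n
  have hsm : Summable fun t => ∑ x, ∑ y, (Q ^ t) x y :=
    summable_of_sum_range_le (c := a 0)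
      (fun t => Finset.sum_nonneg fun x _ => Finset.sum_nonneg fun y _ => hQpos t x y)
      (fun n => by rw [hpart]; linarith [hapos n])
  have hlim : Filter.Tendsto a Filter.atTop (nhds 0) :=
    squeeze_zero hapos hle (by simpa using hsm.tendsto_atTop_zero.const_mul (∑ y, w y))
  have htsum : ∑' t, ∑ x, ∑ y, (Q ^ t) x y = a 0 := by
    refine tendsto_nhds_unique hsm.hasSum.tendsto_sum_nat ?_
    simp only [hpart]
    simpa using hlim.const_sub (a 0)
  have ha0 : a 0 = ∑ x, h x := by
    simp only [ha, hw, pow_zero, Matrix.one_mulVec]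
    rw [← Finset.sum_subtype (Finset.univ.erase m) (by simp) h,
      ← Finset.add_sum_erase _ _ (Finset.mem_univ m), hh.marked, zero_add]
  rw [hittingTime, tsum_mul_left, htsum, ha0]

end Poisson

section Search

variable {V : Type*} [Fintype V] [DecidableEq V] {G : SimpleGraph V} {d : ℕ}

/-- The initial state, scaled by `√(N - 1) · √(d + ℓ)`. -/
def initWeight (m : V) (d : ℕ) (ℓ : ℝ) : V × Fin (d + 1) → ℝ :=
  fun p => if p.1 = m then 0 else coinWeight d ℓ p.2

/-- A fixed vector of the walk, for self-loop weight `ℓ = d / N`. -/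
def fixedWeight (m : V) (d : ℕ) (ℓ : ℝ) : V × Fin (d + 1) → ℝ :=
  fun p => if p = (m, Fin.last d) then -(Fintype.card V * Real.sqrt ℓ) else coinWeight d ℓ p.2

/-- A vector `g` such that `U g - g` is a combination of the initial state and the fixed vector. -/
def potential (L : Labeling G d) (m : V) (ℓ : ℝ) (h : V → ℝ) : V × Fin (d + 1) → ℝ :=
  fun p => Fin.lastCases (motive := fun _ => ℝ)
    (if p.1 = m then -(2 * Fintype.card V * (Fintype.card V - 1) * Real.sqrt ℓ)
      else -(2 * Fintype.card V * Real.sqrt ℓ))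
    (fun i => (Fintype.card V + 1) * (h p.1 - h (L.nbr p.1 i)) +
      if p.1 = m then (2 * (Fintype.card V - 1) : ℝ) else -(2 * Fintype.card V)) p.2

variable {L : Labeling G d} {m : V} {h : V → ℝ}

lemma coinStep_apply_eq (m : V) (ℓ : ℝ) (v : V × Fin (d + 1) → ℝ) (x : V) (a : Fin (d + 1)) :
    coinStep m ℓ v (x, a) = (if x = m then -1 else 1) *
      (2 / (d + ℓ) * coinWeight d ℓ a *
        (∑ i : Fin d, v (x, i.castSucc) + Real.sqrt ℓ * v (x, Fin.last d)) - v (x, a)) := by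
  simp [coinStep, Fin.sum_univ_castSucc]

lemma walkStep_fixedWeight (L : Labeling G d) (m : V) (hd : 1 ≤ d) :
    walkStep L m ((d : ℝ) / Fintype.card V) (fixedWeight m d ((d : ℝ) / Fintype.card V)) =
      fixedWeight m d ((d : ℝ) / Fintype.card V) := by
  set n : ℝ := (Fintype.card V : ℝ) with hn
  have hn0 : 0 < n := by
    have := Fintype.card_pos_iff.mpr ⟨m⟩
    rw [hn]
    exact_mod_cast this
  have hd0 : (0 : ℝ) < d := by exact_mod_cast hd
  set ℓ : ℝ := d / n with hℓ
  have hs : Real.sqrt ℓ * Real.sqrt ℓ = d / n := Real.mul_self_sqrt (by positivity)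
  have hcoin : coinStep m ℓ (fixedWeight m d ℓ) = fixedWeight m d ℓ := by
    ext ⟨x, a⟩
    rw [coinStep_apply_eq]
    by_cases hx : x = m
    · subst hx
      have : ∑ i : Fin d, fixedWeight x d ℓ (x, i.castSucc) +
          Real.sqrt ℓ * fixedWeight x d ℓ (x, Fin.last d) = 0 := by
        simp only [fixedWeight, Prod.mk.injEq, (Fin.castSucc_lt_last _).ne, and_false, if_false,
          coinWeight_castSucc, Finset.sum_const, Finset.card_univ, Fintype.card_fin,
          nsmul_eq_mul, if_true, ← hn]
        rw [mul_neg, mul_left_comm, hs]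
        field_simp
        ring
      rw [this]
      simp
    · have h1 : ∀ b, fixedWeight m d ℓ (x, b) = coinWeight d ℓ b := by
        intro b
        simp [fixedWeight, hx]
      have hk : 2 / ((d : ℝ) + ℓ) * (d + ℓ) = 2 := div_mul_cancel₀ _ (by positivity)
      simp only [h1, hx, if_false, coinWeight_castSucc, coinWeight_last, hs, Finset.sum_const,
        Finset.card_univ, Fintype.card_fin, nsmul_eq_mul, mul_one, ← hℓ]
      linear_combination coinWeight d ℓ a * hk
  ext ⟨x, a⟩
  rw [walkStep_apply, hcoin]
  induction a using Fin.lastCases with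
  | last => rw [shiftFun_last]
  | cast i => simp [shiftFun_castSucc, fixedWeight, (Fin.castSucc_lt_last _).ne]

lemma coinStep_potential (hG : G.Connected) (hLAT : LocallyArcTransitive G) (hd : 1 ≤ d)
    (hh : IsHittingFun L m h) (p : V × Fin (d + 1)) :
    coinStep m ((d : ℝ) / Fintype.card V) (potential L m ((d : ℝ) / Fintype.card V) h) p =
      Fin.lastCases (motive := fun _ => ℝ) 0
        (fun i => (Fintype.card V + 1) * (h (L.nbr p.1 i) - h p.1)) p.2 := by
  obtain ⟨x, a⟩ := p
  have hnbr := hh.nbr_marked hG hLAT hd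
  set n : ℝ := (Fintype.card V : ℝ) with hn
  have hn0 : 0 < n := by
    have := Fintype.card_pos_iff.mpr ⟨m⟩
    rw [hn]
    exact_mod_cast this
  have hd0 : (0 : ℝ) < d := by exact_mod_cast hd
  set ℓ : ℝ := d / n with hℓ
  have hs : Real.sqrt ℓ * Real.sqrt ℓ = d / n := Real.mul_self_sqrt (by positivity)
  rw [coinStep_apply_eq]
  have hk : 2 / ((d : ℝ) + ℓ) = 2 * n / (d * (n + 1)) := by
    rw [hℓ]
    field_simp
  rw [hk]
  by_cases hx : x = m
  · subst hx
    have hS : ∑ i : Fin d, potential L x ℓ h (x, i.castSucc) +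
        Real.sqrt ℓ * potential L x ℓ h (x, Fin.last d) = -(d * (n - 1) * (n + 1)) := by
      simp only [potential, Fin.lastCases_castSucc, Fin.lastCases_last, if_true, hnbr, hh.marked,
        ← hn, Finset.sum_const, Finset.card_univ, Fintype.card_fin, nsmul_eq_mul]
      rw [mul_neg, mul_left_comm, hs]
      field_simp
      ring
    rw [hS]
    induction a using Fin.lastCases with
    | last =>
      simp only [potential, Fin.lastCases_last, if_true, coinWeight_last, ← hn]
      field_simp
      ring
    | cast i =>
      simp only [potential, Fin.lastCases_castSucc, if_true, coinWeight_castSucc, ← hn, hnbr,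
        hh.marked]
      field_simp
      ring
  · have hS : ∑ i : Fin d, potential L m ℓ h (x, i.castSucc) +
        Real.sqrt ℓ * potential L m ℓ h (x, Fin.last d) = -(d * (n + 1)) := by
      simp only [potential, Fin.lastCases_castSucc, Fin.lastCases_last, hx, if_false,
        ← hn, Finset.sum_add_distrib, ← Finset.mul_sum, hh.poisson x hx, Finset.sum_const,
        Finset.card_univ, Fintype.card_fin, nsmul_eq_mul]
      rw [mul_neg (Real.sqrt ℓ), mul_left_comm, hs]
      field_simp
      ring
    rw [hS]
    induction a using Fin.lastCases with
    | last =>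
      simp only [potential, Fin.lastCases_last, hx, if_false, coinWeight_last, ← hn]
      field_simp
      ring
    | cast i =>
      simp only [potential, Fin.lastCases_castSucc, hx, if_false, coinWeight_castSucc, ← hn]
      field_simp
      ring

lemma walkStep_potential_sub (hG : G.Connected) (hLAT : LocallyArcTransitive G) (hd : 1 ≤ d)
    (hh : IsHittingFun L m h) :
    (walkStep L m ((d : ℝ) / Fintype.card V) - 1)
        (potential L m ((d : ℝ) / Fintype.card V) h) =
      (2 * (2 * Fintype.card V - 1) : ℝ) • initWeight m d ((d : ℝ) / Fintype.card V) -
        (2 * (Fintype.card V - 1) : ℝ) • fixedWeight m d ((d : ℝ) / Fintype.card V) := by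
  ext ⟨x, a⟩
  simp only [LinearMap.sub_apply, Module.End.one_apply, Pi.sub_apply, Pi.smul_apply, smul_eq_mul]
  rw [walkStep_apply]
  induction a using Fin.lastCases with
  | last =>
    rw [shiftFun_last, coinStep_potential hG hLAT hd hh]
    simp only [potential, Fin.lastCases_last, initWeight, fixedWeight,
      coinWeight_last, Prod.mk.injEq, and_true]
    split_ifs <;> ring
  | cast i =>
    rw [shiftFun_castSucc, coinStep_potential hG hLAT hd hh]
    simp only [potential, Fin.lastCases_castSucc, initWeight, fixedWeight,
      coinWeight_castSucc, Prod.mk.injEq, (Fin.castSucc_lt_last _).ne, and_false, if_false,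
      L.nbr_idx]
    split_ifs <;> ring

lemma sum_potential_sq (hG : G.Connected) (hLAT : LocallyArcTransitive G) (hd : 1 ≤ d)
    (hh : IsHittingFun L m h) :
    ∑ p, potential L m ((d : ℝ) / Fintype.card V) h p ^ 2 =
      (Fintype.card V + 1) ^ 2 * (2 * d * ∑ x, h x) := by
  rw [← sum_coinStep_sq m (ℓ := (d : ℝ) / Fintype.card V) (by positivity) hd, ← hh.sum_sub_sq, Fintype.sum_prod_type,
    Finset.mul_sum]
  refine Finset.sum_congr rfl fun x _ => ?_
  simp only [coinStep_potential hG hLAT hd hh, Fin.sum_univ_castSucc, Fin.lastCases_castSucc,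
    Fin.lastCases_last]
  rw [Finset.mul_sum, zero_pow two_ne_zero, add_zero]
  exact Finset.sum_congr rfl fun i _ => by ring

lemma sum_walkStep_pow_initWeight (hG : G.Connected) (hLAT : LocallyArcTransitive G) (hd : 1 ≤ d)
    (hh : IsHittingFun L m h) (T : ℕ) (p : V × Fin (d + 1)) :
    2 * (2 * (Fintype.card V : ℝ) - 1) * ∑ t ∈ Finset.range T,
        (walkStep L m ((d : ℝ) / Fintype.card V) ^ t)
          (initWeight m d ((d : ℝ) / Fintype.card V)) p =
      2 * ((Fintype.card V : ℝ) - 1) * T * fixedWeight m d ((d : ℝ) / Fintype.card V) p +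
      ((walkStep L m ((d : ℝ) / Fintype.card V) ^ T)
        (potential L m ((d : ℝ) / Fintype.card V) h) p -
        potential L m ((d : ℝ) / Fintype.card V) h p) := by
  set U := walkStep L m ((d : ℝ) / Fintype.card V)
  set g := potential L m ((d : ℝ) / Fintype.card V) h
  set u := initWeight m d ((d : ℝ) / Fintype.card V)
  set w := fixedWeight m d ((d : ℝ) / Fintype.card V)
  have hw : ∀ t : ℕ, (U ^ t) w = w := by
    intro t
    induction t with
    | zero => rfl
    | succ t ih => rw [pow_succ', Module.End.mul_apply, ih]; exact walkStep_fixedWeight L m hd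
  have key := congrArg (fun A : Module.End ℝ (V × Fin (d + 1) → ℝ) => A g p) (geom_sum_mul U T)
  simp only [Module.End.mul_apply] at key
  rw [walkStep_potential_sub hG hLAT hd hh] at key
  simp only [LinearMap.sum_apply, map_sub, map_smul, Finset.sum_apply, LinearMap.sub_apply,
    Pi.sub_apply, Pi.smul_apply, smul_eq_mul, Module.End.one_apply] at key
  change _ * ∑ t ∈ Finset.range T, (U ^ t) u p - _ * ∑ t ∈ Finset.range T, (U ^ t) w p = _ at key
  simp only [hw, Finset.sum_const, Finset.card_range, nsmul_eq_mul] at key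
  linarith

lemma exists_initWeight_amplitude [DecidableRel G.Adj] (L : Labeling G d) (m : V)
    (hG : G.Connected) (hLAT : LocallyArcTransitive G) (hd : 1 ≤ d) (hN : 3 ≤ Fintype.card V) :
    ∃ t : ℕ, (t : ℝ) ≤ 8 * Real.sqrt (hittingTime (Pmat G d) m) ∧
      (Fintype.card V : ℝ) * (Fintype.card V - 1) * Real.sqrt ((d : ℝ) / Fintype.card V) ≤
        2 * (2 * Fintype.card V - 1) *
        |(walkStep L m ((d : ℝ) / Fintype.card V) ^ t)
          (initWeight m d ((d : ℝ) / Fintype.card V)) (m, Fin.last d)| := by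
  obtain ⟨h, hh⟩ := exists_isHittingFun hG L m
  have hHT := hh.hittingTime_eq hd
  have hE := sum_potential_sq hG hLAT hd hh
  have hsum := fun T => sum_walkStep_pow_initWeight hG hLAT hd hh T (m, Fin.last d)
  have hℓ : 0 ≤ (d : ℝ) / Fintype.card V := by positivity
  have hiso := sum_walkStep_pow_sq L m hℓ hd (potential L m ((d : ℝ) / Fintype.card V) h)
  have hfix : fixedWeight m d ((d : ℝ) / Fintype.card V) (m, Fin.last d) =
      -(Fintype.card V * Real.sqrt ((d : ℝ) / Fintype.card V)) := by
    simp [fixedWeight]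
  set n : ℝ := (Fintype.card V : ℝ) with hn
  have hn3 : 3 ≤ n := by rw [hn]; exact_mod_cast hN
  set U := walkStep L m ((d : ℝ) / n)
  set g := potential L m ((d : ℝ) / n) h
  set u := initWeight m d ((d : ℝ) / n)
  set s := Real.sqrt ((d : ℝ) / n) with hs
  have hd0 : (0 : ℝ) < d := by exact_mod_cast hd
  have hs0 : 0 < s := Real.sqrt_pos.mpr (by positivity)
  have hs2 : s ^ 2 = d / n := Real.sq_sqrt hℓ
  set HT := hittingTime (Pmat G d) m
  have hHT0 : 0 ≤ HT := by
    rw [hHT]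
    exact mul_nonneg (by positivity) (Finset.sum_nonneg fun x _ => hh.nonneg hd x)
  set r := Real.sqrt HT with hr
  have hr0 : 0 ≤ r := Real.sqrt_nonneg _
  have hr2 : r ^ 2 = HT := Real.sq_sqrt hHT0
  have hbound : ∀ v : V × Fin (d + 1) → ℝ, ∑ p, v p ^ 2 = ∑ p, g p ^ 2 →
      |v (m, Fin.last d)| ≤ 3 / 2 * (s * n * (n + 1) * r) := by
    intro v hv
    refine abs_le_of_sq_le_sq ?_ (by positivity)
    have h1 : v (m, Fin.last d) ^ 2 ≤ ∑ p, v p ^ 2 :=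
      Finset.single_le_sum (f := fun p => v p ^ 2) (fun p _ => sq_nonneg _) (Finset.mem_univ _)
    have h2 : ∑ p, g p ^ 2 = 2 * (s * n * (n + 1) * r) ^ 2 := by
      have : ∑ x, h x = n * HT := by
        rw [hHT]
        field_simp
      rw [hE, this, mul_pow, mul_pow, mul_pow, hs2, hr2]
      field_simp
    rw [hv, h2] at h1
    nlinarith [sq_nonneg (s * n * (n + 1) * r)]
  by_contra! hcon
  set T := ⌊8 * r⌋₊ + 1 with hT
  have hTr : 8 * r < T := by
    rw [hT]
    push_cast
    exact Nat.lt_floor_add_one _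
  have hT0 : (0 : ℝ) < T := by positivity
  have hlt : 2 * (2 * n - 1) * |∑ t ∈ Finset.range T, (U ^ t) u (m, Fin.last d)| <
      T * (n * (n - 1) * s) := by
    calc 2 * (2 * n - 1) * |∑ t ∈ Finset.range T, (U ^ t) u (m, Fin.last d)|
        ≤ 2 * (2 * n - 1) * ∑ t ∈ Finset.range T, |(U ^ t) u (m, Fin.last d)| :=
          mul_le_mul_of_nonneg_left (Finset.abs_sum_le_sum_abs _ _) (by linarith)
      _ = ∑ t ∈ Finset.range T, 2 * (2 * n - 1) * |(U ^ t) u (m, Fin.last d)| :=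
          Finset.mul_sum _ _ _
      _ < ∑ t ∈ Finset.range T, n * (n - 1) * s := by
          refine Finset.sum_lt_sum_of_nonempty ⟨0, by simp [hT]⟩ fun t ht => hcon t ?_
          have : t ≤ ⌊8 * r⌋₊ := by
            have := Finset.mem_range.mp ht
            omega
          exact (Nat.cast_le.mpr this).trans (Nat.floor_le (by positivity))
      _ = T * (n * (n - 1) * s) := by simp
  have h1 := abs_le.mp (hbound _ (hiso T))
  have h2 := abs_le.mp (hbound g rfl)
  have h3 := hsum T
  rw [hfix] at h3
  have h4 := neg_abs_le (∑ t ∈ Finset.range T, (U ^ t) u (m, Fin.last d))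
  have h5 := mul_le_mul_of_nonneg_left h4 (show 0 ≤ 2 * (2 * n - 1) by linarith)
  have h6 : s * n * (n + 1) * r ≤ s * n * (n - 1) * (T / 4) := by
    have h7 : (n + 1) * r ≤ (n - 1) * (T / 4) := by nlinarith
    have := mul_le_mul_of_nonneg_left h7 (show 0 ≤ s * n by positivity)
    linarith
  have h8 : 0 < s * n * (n - 1) * T := by
    have : 0 < n - 1 := by linarith
    positivity
  nlinarith

end Search

theorem statement_0 :
    ∃ C > (0 : ℝ), ∃ p > (0 : ℝ),
      ∀ (V : Type) [Fintype V] [DecidableEq V]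
        (G : SimpleGraph V) [DecidableRel G.Adj]
        (d : ℕ) (L : Labeling G d) (m : V),
        1 ≤ d → 3 ≤ Fintype.card V → G.Connected → G.IsRegularOfDegree d →
        LocallyArcTransitive G →
        ∃ t : ℕ,
          (t : ℝ) ≤ C * Real.sqrt (hittingTime (Pmat G d) m) ∧
          p ≤ ∑ a : Fin (d + 1),
            Complex.normSq
              ((Ulazy L m ((d : ℝ) / (Fintype.card V : ℝ)) ^ t).mulVec
                (initLazy m d ((d : ℝ) / (Fintype.card V : ℝ))) (m, a)) := by
  refine ⟨8, by norm_num, 1 / 32, by norm_num, ?_⟩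
  intro V _ _ G _ d L m hd hN hG _ hLAT
  obtain ⟨t, ht, hamp⟩ := exists_initWeight_amplitude L m hG hLAT hd hN
  refine ⟨t, ht, ?_⟩
  have hℓ : 0 ≤ (d : ℝ) / Fintype.card V := by positivity
  set n : ℝ := (Fintype.card V : ℝ) with hn
  have hn3 : 3 ≤ n := by rw [hn]; exact_mod_cast hN
  have hd0 : (0 : ℝ) < d := by exact_mod_cast hd
  set ℓ : ℝ := d / n with hℓd
  set κ : ℝ := 1 / Real.sqrt (n - 1) / Real.sqrt (d + ℓ) with hκ
  have hinit : initLazy m d ℓ = fun p => ((κ • initWeight m d ℓ) p : ℂ) := by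
    ext p
    simp only [initLazy, initWeight, coinVec_eq, Pi.smul_apply, smul_eq_mul, ← hn, hκ]
    split_ifs
    · simp
    · push_cast
      ring
  rw [hinit, Ulazy_pow_mulVec_ofReal L m hℓ, map_smul]
  refine le_trans ?_ (Finset.single_le_sum (fun a _ => Complex.normSq_nonneg _)
    (Finset.mem_univ (Fin.last d)))
  simp only [Pi.smul_apply, smul_eq_mul, Complex.normSq_ofReal]
  set A := (walkStep L m ℓ ^ t) (initWeight m d ℓ) (m, Fin.last d)
  have hκ2 : κ ^ 2 = n / (d * (n - 1) * (n + 1)) := by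
    have h1 : (0 : ℝ) ≤ n - 1 := by linarith
    rw [hκ, div_pow, div_pow, Real.sq_sqrt h1, Real.sq_sqrt (by positivity), hℓd]
    field_simp
  have hsq : (n * (n - 1)) ^ 2 * (d / n) ≤ (2 * (2 * n - 1)) ^ 2 * A ^ 2 := by
    rw [← sq_abs A, ← hℓd, ← Real.sq_sqrt hℓ, ← mul_pow, ← mul_pow]
    refine pow_le_pow_left₀ ?_ hamp 2
    have : 0 ≤ n - 1 := by linarith
    positivity
  have hn1 : 0 < n - 1 := by linarith
  have h2n : 0 < 2 * n - 1 := by linarith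
  have hA : (n * (n - 1)) ^ 2 * (d / n) / (2 * (2 * n - 1)) ^ 2 ≤ A ^ 2 := by
    rw [div_le_iff₀ (by positivity)]
    linarith
  calc (1 / 32 : ℝ) ≤ n / (d * (n - 1) * (n + 1)) *
        ((n * (n - 1)) ^ 2 * (d / n) / (2 * (2 * n - 1)) ^ 2) := by
        have : n / (d * (n - 1) * (n + 1)) *
            ((n * (n - 1)) ^ 2 * (d / n) / (2 * (2 * n - 1)) ^ 2) =
            n ^ 2 * (n - 1) / ((n + 1) * (2 * (2 * n - 1)) ^ 2) := by
          field_simp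
        rw [this, div_le_div_iff₀ (by norm_num) (by positivity)]
        nlinarith [mul_nonneg (sq_nonneg n) (sub_nonneg.mpr hn3), sq_nonneg n]
    _ ≤ κ ^ 2 * A ^ 2 := by
        rw [hκ2]
        exact mul_le_mul_of_nonneg_left hA (by positivity)
    _ = κ * A * (κ * A) := by ring

end LQWPaper
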